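/- arXiv:1412.3614 — 4 statements merged into one kernel-verified Lean document; each statement's English description precedes it below -/
import Mathlib

section
/- Let G and H be groups and let M be a nonempty set equipped with a left G-action and a right H-action that commute with each other (g•(m•h) = (g•m)•h for all g ∈ G, m ∈ M, h ∈ H), such that both actions are free and transitive. Then G and H are isomorphic as groups. -/
/-- Let `G` and `H` be groups and let `M` be a nonempty set equipped with a
left `G`-action `l` and a right `H`-action `r` that commute with each other, such that both
actions are free and transitive.  Then `G` and `H` are isomorphic as groups. -/
theorem operadic_torsors_stmt0 {G H M : Type*} [Group G] [Group H] [Nonempty M]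
    (l : G → M → M) (r : M → H → M)
    (hl_one : ∀ m, l 1 m = m)
    (hl_mul : ∀ g g' m, l (g * g') m = l g (l g' m))
    (hr_one : ∀ m, r m 1 = m)
    (hr_mul : ∀ m h h', r m (h * h') = r (r m h) h')
    (hcomm : ∀ g m h, l g (r m h) = r (l g m) h)
    (hl_free : ∀ g m, l g m = m → g = 1)
    (hl_trans : ∀ m m', ∃ g, l g m = m')
    (hr_free : ∀ h m, r m h = m → h = 1)
    (hr_trans : ∀ m m', ∃ h, r m h = m') :
    Nonempty (G ≃* H) := by
  obtain ⟨m⟩ := ‹Nonempty M›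
  have r_inj : ∀ h h', r m h = r m h' → h = h' := fun h h' e ↦
    mul_inv_eq_one.mp <| hr_free _ m <| by
      rw [hr_mul, e, ← hr_mul, mul_inv_cancel, hr_one]
  have l_inj : ∀ g g', l g m = l g' m → g = g' := fun g g' e ↦
    inv_mul_eq_one.mp <| hl_free _ m <| by
      rw [hl_mul, ← e, ← hl_mul, inv_mul_cancel, hl_one]
  choose φ hφ using fun g ↦ hr_trans m (l g m)
  refine ⟨MulEquiv.ofBijective (MonoidHom.mk' φ fun g g' ↦ r_inj _ _ ?_) ⟨?_, ?_⟩⟩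
  · rw [hφ, hl_mul, ← hφ g', hcomm, ← hφ g, hr_mul]
  · intro g g' (e : φ g = φ g')
    exact l_inj _ _ (by rw [← hφ, e, hφ])
  · intro h
    obtain ⟨g, hg⟩ := hl_trans m (r m h)
    exact ⟨g, r_inj _ _ ((hφ g).trans hg)⟩
end

section
/- Let P and Q be (associative, unital) rings and let M be a (P,Q)-bimodule, i.e. an abelian group with a left P-module structure and a right Q-module structure satisfying (p·m)·q = p·(m·q). Suppose there exists m₀ ∈ M such that the maps P → M, p ↦ p·m₀ and Q → M, q ↦ m₀·q are both bijective. Then P and Q are isomorphic as rings. -/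
/-- Let `P` and `Q` be rings and `M` a `(P,Q)`-bimodule (left `P`-module and
right `Q`-module, i.e. left `Qᵐᵒᵖ`-module, with commuting actions `(p • m) • q = p • (m • q)`).
If there is `m₀ ∈ M` such that `p ↦ p • m₀` and `q ↦ m₀ • q` are both bijective, then `P` and
`Q` are isomorphic as rings. -/
theorem operadic_torsors_stmt4 {P Q M : Type*} [Ring P] [Ring Q]
    [AddCommGroup M] [Module P M] [Module Qᵐᵒᵖ M] [SMulCommClass P Qᵐᵒᵖ M]
    (m₀ : M)
    (hP : Function.Bijective (fun p : P => p • m₀))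
    (hQ : Function.Bijective (fun q : Q => MulOpposite.op q • m₀)) :
    Nonempty (P ≃+* Q) := by
  let e : P ≃ Q := (Equiv.ofBijective _ hP).trans (Equiv.ofBijective _ hQ).symm
  have he (p : P) : MulOpposite.op (e p) • m₀ = p • m₀ :=
    (Equiv.ofBijective _ hQ).apply_symm_apply (p • m₀)
  refine ⟨{ e with map_mul' := fun a b => hQ.injective ?_, map_add' := fun a b => hQ.injective ?_ }⟩
  · change MulOpposite.op (e (a * b)) • m₀ = MulOpposite.op (e a * e b) • m₀
    rw [he, MulOpposite.op_mul, mul_smul, mul_smul, he, ← he b, smul_comm]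
  · change MulOpposite.op (e (a + b)) • m₀ = MulOpposite.op (e a + e b) • m₀
    rw [he, MulOpposite.op_add, add_smul, add_smul, he, he]
end

section
/- Let P and Q be rings and let M be a (P,Q)-bimodule admitting an element m₀ ∈ M such that p ↦ p·m₀ and q ↦ m₀·q are bijective. Then the ring homomorphism ρ : P → End_Q(M) from P to the ring of right-Q-linear endomorphisms of M (additive endomorphisms φ with φ(m·q) = φ(m)·q), given by ρ(p)(m) = p·m, is a ring isomorphism. -/
/-- Let `P`, `Q` be rings and `M` a `(P,Q)`-bimodule admitting `m₀ ∈ M` with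
`p ↦ p • m₀` and `q ↦ m₀ • q` bijective.  Then the ring homomorphism
`ρ : P → End_Q(M)`, `ρ p m = p • m`, from `P` to the ring of right `Q`-linear endomorphisms
of `M` (i.e. `Qᵐᵒᵖ`-linear endomorphisms) is a ring isomorphism. -/
theorem operadic_torsors_stmt5 {P Q M : Type*} [Ring P] [Ring Q]
    [AddCommGroup M] [Module P M] [Module Qᵐᵒᵖ M] [SMulCommClass P Qᵐᵒᵖ M]
    (m₀ : M)
    (hP : Function.Bijective (fun p : P => p • m₀))
    (hQ : Function.Bijective (fun q : Q => MulOpposite.op q • m₀)) :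
    ∃ e : P ≃+* Module.End Qᵐᵒᵖ M, ∀ (p : P) (m : M), e p m = p • m := by
  refine ⟨RingEquiv.ofBijective (Module.toModuleEnd Qᵐᵒᵖ (S := P) M) ⟨fun p p' h => ?_, fun φ => ?_⟩,
    fun _ _ => rfl⟩
  · exact hP.1 (LinearMap.congr_fun h m₀)
  · obtain ⟨p, hp⟩ := hP.2 (φ m₀)
    refine ⟨p, LinearMap.ext fun m => ?_⟩
    obtain ⟨q, rfl⟩ := hQ.2 m
    change p • MulOpposite.op q • m₀ = φ (MulOpposite.op q • m₀)
    rw [smul_comm, map_smul]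
    exact congrArg (MulOpposite.op q • ·) hp
end

section
/- Let K be a field and let f : N → M and g : M → N be quasi-isomorphisms of ℤ-indexed cochain complexes of K-vector spaces. Then the morphism of cochain complexes f̄ : Hom•(N, N) → Hom•(M, M), λ ↦ f ∘ λ ∘ g, is a quasi-isomorphism. -/
open CategoryTheory CochainComplex.HomComplex

universe v u

theorem LinearMap.exists_comp_comp_eq_self {K V W : Type*} [DivisionRing K]
    [AddCommGroup V] [Module K V] [AddCommGroup W] [Module K W] (d : V →ₗ[K] W) :
    ∃ s : W →ₗ[K] V, d ∘ₗ s ∘ₗ d = d := by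
  obtain ⟨t, ht⟩ := d.rangeRestrict.exists_rightInverse_of_surjective d.range_rangeRestrict
  obtain ⟨s, hs⟩ := LinearMap.exists_extend t
  refine ⟨s, LinearMap.ext fun x ↦ ?_⟩
  have h₁ : s (d x) = t (d.rangeRestrict x) := LinearMap.congr_fun hs (d.rangeRestrict x)
  have h₂ := congrArg Subtype.val (LinearMap.congr_fun ht (d.rangeRestrict x))
  simpa [h₁] using h₂

namespace CochainComplex

lemma homotopy_id_zero_of_acyclic {K : Type u} [Field K]
    {L : CochainComplex (ModuleCat.{v} K) ℤ} (hL : L.Acyclic) :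
    Nonempty (Homotopy (𝟙 L) 0) := by
  have hs (p q : ℤ) : ∃ s : L.X q ⟶ L.X p, L.d p q ≫ s ≫ L.d p q = L.d p q := by
    obtain ⟨s, hs⟩ := (L.d p q).hom.exists_comp_comp_eq_self
    exact ⟨ModuleCat.ofHom s, ModuleCat.hom_ext hs⟩
  choose s hs using hs
  let u (n : ℤ) : L.X n ⟶ L.X n := 𝟙 _ - L.d n (n + 1) ≫ s n (n + 1)
  have key (n : ℤ) : u n ≫ s (n - 1) n ≫ L.d (n - 1) n = u n := by
    have hex := (L.exactAt_iff' (n - 1) n (n + 1) (by simp) (by simp)).1 (hL n)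
    rw [ShortComplex.moduleCat_exact_iff] at hex
    have hu : u n ≫ L.d n (n + 1) = 0 := by
      simp [u, Preadditive.sub_comp, hs]
    ext x
    obtain ⟨w, hw⟩ := hex (u n x) (ConcreteCategory.congr_hom hu x)
    have h := ConcreteCategory.congr_hom (hs (n - 1) n) w
    change L.d (n - 1) n (s (n - 1) n (u n x)) = u n x
    rw [← hw]
    exact h
  refine ⟨(Cochain.equivHomotopy _ _).symm
    ⟨Cochain.mk fun p q _ ↦ u p ≫ s q p, ?_⟩⟩
  ext n
  rw [Cochain.add_v, δ_v (-1) 0 (by simp) _ n n (by simp) (n - 1) (n + 1) rfl rfl]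
  simp only [Cochain.mk_v, Category.assoc, key]
  simp [u, Preadditive.comp_sub]

lemma isKInjective_of_field {K : Type u} [Field K] (L : CochainComplex (ModuleCat.{v} K) ℤ) :
    L.IsKInjective where
  nonempty_homotopy_zero f hK := by
    obtain ⟨h⟩ := homotopy_id_zero_of_acyclic hK
    exact ⟨(Homotopy.ofEq (by simp)).trans ((h.compRight f).trans (Homotopy.ofEq (by simp)))⟩

namespace HomComplex

variable {C : Type u} [Category.{v} C] [Preadditive C] {F G H : CochainComplex C ℤ}

/-- Precomposition with a morphism, as a morphism between complexes of homomorphisms. -/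
noncomputable def precomp (φ : F ⟶ G) (H : CochainComplex C ℤ) :
    HomComplex G H ⟶ HomComplex F H where
  f n := AddCommGrpCat.ofHom
    (AddMonoidHom.mk' (fun z : Cochain G H n ↦ (Cochain.ofHom φ).comp z (zero_add n))
      fun _ _ ↦ by simp)
  comm' i j _ := by
    ext z
    exact δ_ofHom_comp φ z j

/-- Postcomposition with a morphism, as a morphism between complexes of homomorphisms. -/
noncomputable def postcomp (F : CochainComplex C ℤ) (φ : G ⟶ H) :
    HomComplex F G ⟶ HomComplex F H where
  f n := AddCommGrpCat.ofHom
    (AddMonoidHom.mk' (fun z : Cochain F G n ↦ z.comp (Cochain.ofHom φ) (add_zero n))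
      fun _ _ ↦ by simp)
  comm' i j _ := by
    ext z
    exact δ_comp_ofHom z φ j

lemma precomp_id (F H : CochainComplex C ℤ) : precomp (𝟙 F) H = 𝟙 _ := by
  ext n z
  exact Cochain.id_comp z

lemma postcomp_id (F G : CochainComplex C ℤ) : postcomp F (𝟙 G) = 𝟙 _ := by
  ext n z
  exact Cochain.comp_id z

lemma precomp_comp {E : CochainComplex C ℤ} (φ : E ⟶ F) (ψ : F ⟶ G) (H : CochainComplex C ℤ) :
    precomp (φ ≫ ψ) H = precomp ψ H ≫ precomp φ H := by
  ext n (z : Cochain G H n)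
  change (Cochain.ofHom (φ ≫ ψ)).comp z (zero_add n) =
    (Cochain.ofHom φ).comp ((Cochain.ofHom ψ).comp z (zero_add n)) (zero_add n)
  simp

lemma postcomp_comp (E : CochainComplex C ℤ) (φ : F ⟶ G) (ψ : G ⟶ H) :
    postcomp E (φ ≫ ψ) = postcomp E φ ≫ postcomp E ψ := by
  ext n (z : Cochain E F n)
  change z.comp (Cochain.ofHom (φ ≫ ψ)) (add_zero n) =
    (z.comp (Cochain.ofHom φ) (add_zero n)).comp (Cochain.ofHom ψ) (add_zero n)
  simp

/-- Precomposition with a cochain of degree `-1`, with the sign making it a component of a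
homotopy between precompositions. -/
noncomputable def precompHomotopyHom (α : Cochain F G (-1)) (H : CochainComplex C ℤ)
    (i j : ℤ) (hij : j + 1 = i) : (HomComplex G H).X i ⟶ (HomComplex F H).X j :=
  AddCommGrpCat.ofHom (AddMonoidHom.mk' (fun z : Cochain G H i ↦
    i.negOnePow • α.comp z (show -1 + i = j by lia)) fun _ _ ↦ by simp)

/-- Postcomposition with a cochain of degree `-1`. -/
noncomputable def postcompHomotopyHom (F : CochainComplex C ℤ) (α : Cochain G H (-1))
    (i j : ℤ) (hij : j + 1 = i) : (HomComplex F G).X i ⟶ (HomComplex F H).X j :=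
  AddCommGrpCat.ofHom (AddMonoidHom.mk' (fun z : Cochain F G i ↦
    z.comp α (show i + -1 = j by lia)) fun _ _ ↦ by simp)

/-- Precompositions with homotopic morphisms are homotopic. -/
noncomputable def precompHomotopy {φ ψ : F ⟶ G} (h : Homotopy φ ψ) (H : CochainComplex C ℤ) :
    Homotopy (precomp φ H) (precomp ψ H) where
  hom i j := if hij : j + 1 = i then precompHomotopyHom (Cochain.ofHomotopy h) H i j hij else 0
  zero i j hij := dif_neg hij
  comm n := by
    rw [dNext_eq _ (show (ComplexShape.up ℤ).Rel n (n + 1) from rfl),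
      prevD_eq _ (show (ComplexShape.up ℤ).Rel (n - 1) n by simp), dif_pos rfl,
      dif_pos (sub_add_cancel n 1)]
    ext (z : Cochain G H n)
    change (Cochain.ofHom φ).comp z (zero_add n) =
      (n + 1).negOnePow • (Cochain.ofHomotopy h).comp (δ n (n + 1) z) (by lia) +
        δ (n - 1) n (n.negOnePow • (Cochain.ofHomotopy h).comp z (by lia)) +
        (Cochain.ofHom ψ).comp z (zero_add n)
    rw [δ_units_smul, δ_comp _ _ _ 0 (n + 1) n (by lia) (by lia) rfl, δ_ofHomotopy]
    simp [Int.negOnePow_succ, smul_smul]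

/-- Postcompositions with homotopic morphisms are homotopic. -/
noncomputable def postcompHomotopy (F : CochainComplex C ℤ) {φ ψ : G ⟶ H} (h : Homotopy φ ψ) :
    Homotopy (postcomp F φ) (postcomp F ψ) where
  hom i j := if hij : j + 1 = i then postcompHomotopyHom F (Cochain.ofHomotopy h) i j hij else 0
  zero i j hij := dif_neg hij
  comm n := by
    rw [dNext_eq _ (show (ComplexShape.up ℤ).Rel n (n + 1) from rfl),
      prevD_eq _ (show (ComplexShape.up ℤ).Rel (n - 1) n by simp), dif_pos rfl,
      dif_pos (sub_add_cancel n 1)]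
    ext (z : Cochain F G n)
    change z.comp (Cochain.ofHom φ) (add_zero n) =
      (δ n (n + 1) z).comp (Cochain.ofHomotopy h) (by lia) +
        δ (n - 1) n (z.comp (Cochain.ofHomotopy h) (by lia)) +
        z.comp (Cochain.ofHom ψ) (add_zero n)
    rw [δ_comp _ _ _ (n + 1) 0 n (by lia) rfl (by lia), δ_ofHomotopy]
    simp

/-- Precomposition with a homotopy equivalence is a homotopy equivalence. -/
noncomputable def precompHomotopyEquiv (e : HomotopyEquiv F G) (H : CochainComplex C ℤ) :
    HomotopyEquiv (HomComplex G H) (HomComplex F H) where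
  hom := precomp e.hom H
  inv := precomp e.inv H
  homotopyHomInvId := (Homotopy.ofEq (precomp_comp _ _ _).symm).trans
    ((precompHomotopy e.homotopyInvHomId H).trans (Homotopy.ofEq (precomp_id _ _)))
  homotopyInvHomId := (Homotopy.ofEq (precomp_comp _ _ _).symm).trans
    ((precompHomotopy e.homotopyHomInvId H).trans (Homotopy.ofEq (precomp_id _ _)))

/-- Postcomposition with a homotopy equivalence is a homotopy equivalence. -/
noncomputable def postcompHomotopyEquiv (F : CochainComplex C ℤ) (e : HomotopyEquiv G H) :
    HomotopyEquiv (HomComplex F G) (HomComplex F H) where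
  hom := postcomp F e.hom
  inv := postcomp F e.inv
  homotopyHomInvId := (Homotopy.ofEq (postcomp_comp _ _ _).symm).trans
    ((postcompHomotopy F e.homotopyHomInvId).trans (Homotopy.ofEq (postcomp_id _ _)))
  homotopyInvHomId := (Homotopy.ofEq (postcomp_comp _ _ _).symm).trans
    ((postcompHomotopy F e.homotopyInvHomId).trans (Homotopy.ofEq (postcomp_id _ _)))

end HomComplex

end CochainComplex

/-- Let `K` be a field and let `f : N → M` and `g : M → N` be
quasi-isomorphisms of `ℤ`-indexed cochain complexes of `K`-vector spaces.  Then the morphism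
of cochain complexes `f̄ : Hom•(N,N) → Hom•(M,M)`, `λ ↦ f ∘ λ ∘ g`, is a
quasi-isomorphism. -/
theorem operadic_torsors_stmt10 {K : Type*} [Field K]
    {M N : CochainComplex (ModuleCat K) ℤ} (f : N ⟶ M) (g : M ⟶ N)
    [QuasiIso f] [QuasiIso g] :
    ∃ Φ : CochainComplex.HomComplex N N ⟶ CochainComplex.HomComplex M M,
      (∀ (n : ℤ) (lam : Cochain N N n),
        Φ.f n lam =
          ((Cochain.ofHom g).comp lam (zero_add n)).comp (Cochain.ofHom f) (add_zero n)) ∧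
      QuasiIso Φ := by
  have := M.isKInjective_of_field
  have := N.isKInjective_of_field
  obtain ⟨e, rfl⟩ := (CochainComplex.IsKInjective.quasiIso_iff f).1 inferInstance
  obtain ⟨e', rfl⟩ := (CochainComplex.IsKInjective.quasiIso_iff g).1 inferInstance
  have : QuasiIso (precomp e'.hom N) := (precompHomotopyEquiv e' N).quasiIso_hom
  have : QuasiIso (postcomp M e.hom) := (postcompHomotopyEquiv M e).quasiIso_hom
  exact ⟨precomp e'.hom N ≫ postcomp M e.hom, fun _ _ ↦ rfl, inferInstance⟩
end
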